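/- For every fixed k ∈ ℕ: if a graph G contains, for every n ∈ ℕ, a family of n pairwise edge-disjoint k-rays, then G contains an infinite family of pairwise edge-disjoint k-rays. -/

import Mathlib

open SimpleGraph

variable {V : Type*}

/-- A ray in `G`: an injective sequence of vertices with consecutive vertices adjacent. -/
def IsRay (G : SimpleGraph V) (f : ℕ → V) : Prop :=
  Function.Injective f ∧ ∀ n, G.Adj (f n) (f (n + 1))

/-- A double ray in `G`: an injective two-way infinite sequence with consecutive
vertices adjacent. -/
def IsDoubleRay (G : SimpleGraph V) (f : ℤ → V) : Prop :=
  Function.Injective f ∧ ∀ n, G.Adj (f n) (f (n + 1))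

/-- The edges used by a ray. -/
def rayEdges (f : ℕ → V) : Set (Sym2 V) := {e | ∃ n, e = s(f n, f (n + 1))}

/-- The edges used by a double ray. -/
def drEdges (f : ℤ → V) : Set (Sym2 V) := {e | ∃ n : ℤ, e = s(f n, f (n + 1))}

/-- Two rays are equivalent (belong to the same end) iff no finite vertex set
separates them: for every finite `S` there are tails of both rays avoiding `S`
which are joined by a walk avoiding `S`. -/
def RayEquiv (G : SimpleGraph V) (f g : ℕ → V) : Prop :=
  ∀ S : Finset V, ∃ a b, (∀ i, a ≤ i → f i ∉ S) ∧ (∀ j, b ≤ j → g j ∉ S) ∧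
    ∃ w : G.Walk (f a) (g b), ∀ v ∈ w.support, v ∉ S

/-- The forward ray of a double ray. -/
def drFwd (f : ℤ → V) : ℕ → V := fun n => f n

/-- The backward ray of a double ray. -/
def drBwd (f : ℤ → V) : ℕ → V := fun n => f (-(n : ℤ) - 1)

/-- The end (represented by the ray `R`) has vertex-degree exactly `k`:
there are `k` pairwise vertex-disjoint rays equivalent to `R`, but not `k + 1`. -/
def EndVertexDegree (G : SimpleGraph V) (R : ℕ → V) (k : ℕ) : Prop :=
  (∃ F : Fin k → ℕ → V, (∀ i, IsRay G (F i) ∧ RayEquiv G R (F i)) ∧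
      Pairwise fun i j => Disjoint (Set.range (F i)) (Set.range (F j))) ∧
  ¬ ∃ F : Fin (k + 1) → ℕ → V, (∀ i, IsRay G (F i) ∧ RayEquiv G R (F i)) ∧
      Pairwise fun i j => Disjoint (Set.range (F i)) (Set.range (F j))

/-- A `k`-ray: a family of `k` pairwise vertex-disjoint rays. -/
def IsKRay (G : SimpleGraph V) {k : ℕ} (F : Fin k → ℕ → V) : Prop :=
  (∀ i, IsRay G (F i)) ∧ Pairwise fun i j => Disjoint (Set.range (F i)) (Set.range (F j))

/-- The edges used by a `k`-ray. -/
def kRayEdges {k : ℕ} (F : Fin k → ℕ → V) : Set (Sym2 V) := ⋃ i, rayEdges (F i)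


/-- A relation stepping along edges of `G` whose components are directed paths and cycles that
never terminate. -/
structure IsRayFlow (G : SimpleGraph V) (R : V → V → Prop) : Prop where
  adj : ∀ {u v}, R u v → G.Adj u v
  functional : ∀ {u v v'}, R u v → R u v' → v = v'
  injective : ∀ {u u' v}, R u v → R u' v → u = u'
  total : ∀ {w u}, R w u → ∃ v, R u v

/-- Distinct sources of a ray flow are starting vertices of disjoint rays following the flow. -/
theorem IsRayFlow.exists_rays {G : SimpleGraph V} {R : V → V → Prop} (hR : IsRayFlow G R)
    {ι : Type*} (b : ι → V) (hb : Function.Injective b) (hout : ∀ i, ∃ v, R (b i) v)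
    (hin : ∀ i w, ¬ R w (b i)) :
    ∃ r : ι → ℕ → V, (∀ i, IsRay G (r i)) ∧
      (Pairwise fun i j => Disjoint (Set.range (r i)) (Set.range (r j))) ∧
      ∀ i n, R (r i n) (r i (n + 1)) := by
  classical
  let nx : V → V := fun u => if h : ∃ v, R u v then h.choose else u
  have hnx : ∀ u, (∃ v, R u v) → R u (nx u) := by
    intro u h
    simp only [nx, dif_pos h]
    exact h.choose_spec
  let r : ι → ℕ → V := fun i n => nx^[n] (b i)
  have hsucc : ∀ i n, r i (n + 1) = nx (r i n) := fun i n =>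
    Function.iterate_succ_apply' nx n (b i)
  have hstep : ∀ i n, R (r i n) (r i (n + 1)) := by
    intro i n
    induction n with
    | zero => rw [hsucc]; exact hnx _ (hout i)
    | succ n ih => rw [hsucc i (n + 1)]; exact hnx _ (hR.total ih)
  have key : ∀ n i n' i', r i n = r i' n' → i = i' ∧ n = n' := by
    intro n
    induction n with
    | zero =>
      intro i n' i' h
      cases n' with
      | zero => exact ⟨hb h, rfl⟩
      | succ n' => exact absurd (h ▸ hstep i' n') (hin i _)
    | succ n ih =>
      intro i n' i' h
      cases n' with
      | zero => exact absurd (h ▸ hstep i n) (hin i' _)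
      | succ n' =>
        obtain ⟨h1, h2⟩ := ih i n' i' (hR.injective (hstep i n) (h ▸ hstep i' n'))
        exact ⟨h1, by rw [h2]⟩
  refine ⟨r, fun i => ⟨fun n n' h => (key n i n' i h).2, fun n => hR.adj (hstep i n)⟩, ?_, hstep⟩
  intro i j hij
  rw [Set.disjoint_left]
  rintro _ ⟨n, rfl⟩ ⟨n', h⟩
  exact hij (key n' j n i h).1.symm

/-- A form of Menger's theorem: if no fewer than `E.card` vertices separate `E` from `E'` inside
`Ω`, then `E` is linked to `E'` in a finite part of `Ω`. The linkage is encoded as an injection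
moving every vertex to itself or to a neighbour. -/
theorem exists_linkage (G : SimpleGraph V) (Ω : Set V) (E E' : Finset V)
    (hE : ∀ e ∈ E, e ∈ Ω) (hE' : ∀ e ∈ E', e ∈ Ω)
    (hsep : ∀ (Z : Finset V) (Q : Set V), Z.card < E.card → (∀ e ∈ E, e ∈ Q ∨ e ∈ Z) →
      (∀ e ∈ E', e ∉ Q) → (∀ a ∈ Q, ∀ b ∈ Ω, G.Adj a b → b ∈ Q ∨ b ∈ Z) → False) :
    ∃ (U : Finset V) (f : V → V), (∀ u ∈ U, u ∈ Ω) ∧ E ⊆ U ∧ E' ⊆ U ∧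
      (∀ u ∈ U, u ∉ E' → f u ∈ U ∧ f u ∉ E ∧ (f u = u ∨ G.Adj u (f u))) ∧
      (∀ u ∈ U, ∀ v ∈ U, u ∉ E' → v ∉ E' → f u = f v → u = v) := by
  classical
  obtain ⟨U, hUΩ, hEU, hE'U, hU⟩ : ∃ U : Finset V, (∀ u ∈ U, u ∈ Ω) ∧ E ⊆ U ∧ E' ⊆ U ∧
      ∀ (Z : Finset V) (Q : Set V), Z.card < E.card → (∀ e ∈ E, e ∈ Q ∨ e ∈ Z) →
      (∀ e ∈ E', e ∉ Q) → (∀ a ∈ Q, ∀ b ∈ U, G.Adj a b → b ∈ Q ∨ b ∈ Z) → False := by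
    by_contra! hcon
    have hT : ∀ T : Finset V, ∃ (Z : Finset V) (Q : Set V), Z.card < E.card ∧
        (∀ e ∈ E, e ∈ Q ∨ e ∈ Z) ∧ (∀ e ∈ E', e ∉ Q) ∧
        (∀ a ∈ Q, ∀ b ∈ T, b ∈ Ω → G.Adj a b → b ∈ Q ∨ b ∈ Z) := by
      intro T
      obtain ⟨Z, Q, h1, h2, h3, h4, -⟩ := hcon (T.filter (· ∈ Ω) ∪ E ∪ E') (by
        intro u hu
        simp only [Finset.mem_union, Finset.mem_filter] at hu
        rcases hu with (hu | hu) | hu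
        · exact hu.2
        · exact hE u hu
        · exact hE' u hu) (by intro x hx; simp [hx]) (by intro x hx; simp [hx])
      exact ⟨Z, Q, h1, h2, h3, fun a ha b hb hbΩ hab => h4 a ha b (by simp [hb, hbΩ]) hab⟩
    choose Z Q h1 h2 h3 h4 using hT
    let 𝒰 : Ultrafilter (Finset V) := Ultrafilter.of Filter.atTop
    have hle : (𝒰 : Filter (Finset V)) ≤ Filter.atTop := Ultrafilter.of_le _
    let Zl : Set V := {v | ∀ᶠ T in (𝒰 : Filter (Finset V)), v ∈ Z T}
    have hfin : ∀ Y : Finset V, (∀ y ∈ Y, y ∈ Zl) → Y.card < E.card := by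
      intro Y hY
      have : ∀ᶠ T in (𝒰 : Filter (Finset V)), ∀ y ∈ Y, y ∈ Z T :=
        (Filter.eventually_all_finset Y).2 hY
      obtain ⟨T, hT⟩ := this.exists
      exact (Finset.card_le_card hT).trans_lt (h1 T)
    have hZf : Zl.Finite := by
      by_contra hinf
      obtain ⟨Y, hY, hc⟩ := Set.Infinite.exists_subset_card_eq hinf E.card
      exact absurd (hfin Y fun y hy => hY hy) (by omega)
    refine hsep hZf.toFinset {v | ∀ᶠ T in (𝒰 : Filter (Finset V)), v ∈ Q T}
      (hfin _ (by simp)) ?_ ?_ ?_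
    · intro e he
      have : ∀ᶠ T in (𝒰 : Filter (Finset V)), e ∈ Q T ∨ e ∈ Z T :=
        Filter.Eventually.of_forall fun T => h2 T e he
      simpa [Zl] using Ultrafilter.eventually_or.1 this
    · intro e he h
      obtain ⟨T, hT⟩ := Filter.Eventually.exists h
      exact h3 T e he hT
    · intro a ha b hb hab
      have hbT : ∀ᶠ T in (𝒰 : Filter (Finset V)), b ∈ T := by
        apply hle
        filter_upwards [Filter.eventually_ge_atTop {b}] with T hT
        exact hT (by simp)
      have : ∀ᶠ T in (𝒰 : Filter (Finset V)), b ∈ Q T ∨ b ∈ Z T := by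
        filter_upwards [ha, hbT] with T h5 h6
        exact h4 T a h5 b h6 hb hab
      simpa [Zl] using Ultrafilter.eventually_or.1 this
  let ι := {u // u ∈ U ∧ u ∉ E'}
  let t : ι → Finset V := fun u => U.filter fun w => w ∉ E ∧ (w = u ∨ G.Adj u w)
  have hall : ∀ s : Finset ι, s.card ≤ (s.biUnion t).card := by
    intro s
    by_contra! hlt
    let X : Finset V := s.map (Function.Embedding.subtype _)
    have hXs : X.card = s.card := Finset.card_map _
    have hX : ∀ {x}, x ∈ X ↔ ∃ h : x ∈ U ∧ x ∉ E', (⟨x, h⟩ : ι) ∈ s := by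
      intro x; simp [X, ι]
    let N := s.biUnion t
    have hN : X \ E ⊆ N ∩ X := by
      intro x hx
      rw [Finset.mem_sdiff] at hx
      obtain ⟨hx1, hx2⟩ := hX.1 hx.1
      refine Finset.mem_inter.2 ⟨Finset.mem_biUnion.2 ⟨_, hx2, ?_⟩, hx.1⟩
      simp [t, hx1.1, hx.2]
    have c1 := Finset.card_le_card hN
    have c2 := Finset.card_sdiff_add_card_inter X E
    have c3 := Finset.card_sdiff_add_card_inter N X
    have c4 := Finset.card_sdiff_add_card_inter E X
    rw [Finset.inter_comm E X] at c4
    have c5 := Finset.card_union_le (E \ X) (N \ X)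
    refine hU ((E \ X) ∪ (N \ X)) X ?_ ?_ ?_ ?_
    · change N.card < s.card at hlt
      omega
    · intro e he
      by_cases h : e ∈ X
      · exact Or.inl h
      · exact Or.inr (by simp [he, h])
    · intro e he h
      obtain ⟨h, -⟩ := hX.1 h
      exact h.2 he
    · intro a ha b hb hab
      by_cases h : b ∈ X
      · exact Or.inl h
      right
      by_cases hbE : b ∈ E
      · simp [hbE, h]
      · obtain ⟨h1, h2⟩ := hX.1 ha
        refine Finset.mem_union_right _ (Finset.mem_sdiff.2
          ⟨Finset.mem_biUnion.2 ⟨_, h2, ?_⟩, h⟩)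
        simp [t, hb, hbE, hab]
  obtain ⟨g, hg, hgt⟩ := (Finset.all_card_le_biUnion_card_iff_exists_injective t).1 hall
  refine ⟨U, fun u => if h : u ∈ U ∧ u ∉ E' then g ⟨u, h⟩ else u, hUΩ, hEU, hE'U, ?_, ?_⟩
  · intro u hu hu'
    have := hgt ⟨u, hu, hu'⟩
    simp only [t, Finset.mem_filter] at this
    simpa [hu, hu'] using this
  · intro u hu v hv hu' hv' h
    simp only [hu, hv, hu', hv', not_false_eq_true, and_self, dite_true] at h
    exact congrArg Subtype.val (hg h)

/-- `G` contains infinitely many pairwise disjoint rays. -/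
def HasDisjointRays (G : SimpleGraph V) : Prop :=
  ∃ r : ℕ → ℕ → V, (∀ i, IsRay G (r i)) ∧
    Pairwise fun i j => Disjoint (Set.range (r i)) (Set.range (r j))

/-- Concatenating infinitely many linkages between growing finite sets `E` gives infinitely many
disjoint rays. The set `X` holds the vertices that later linkages have to avoid. -/
theorem hasDisjointRays_of_linkages (G : SimpleGraph V) (P : Set V → Finset V → Prop)
    (hP : ∃ X E, P X E)
    (hstep : ∀ X E, P X E → ∃ X' E', P X' E' ∧ E.card < E'.card ∧ (∀ e ∈ E, e ∉ E') ∧ X ⊆ X' ∧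
      ∃ (U : Finset V) (f : V → V), (∀ u ∈ U, u ∉ X) ∧ (∀ u ∈ U, u ∉ E' → u ∈ X') ∧
        E ⊆ U ∧ E' ⊆ U ∧
        (∀ u ∈ U, u ∉ E' → f u ∈ U ∧ f u ∉ E ∧ (f u = u ∨ G.Adj u (f u))) ∧
        (∀ u ∈ U, ∀ v ∈ U, u ∉ E' → v ∉ E' → f u = f v → u = v)) :
    HasDisjointRays G := by
  classical
  obtain ⟨X₀, E₀, h₀⟩ := hP
  have : Nonempty (V → V) := ⟨id⟩
  choose! X' E' hP' hcard hdisj hmono U' f' hUX hUX' hEU hE'U hf hinj using hstep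
  let st : ℕ → Set V × Finset V := fun n =>
    Nat.rec (X₀, E₀) (fun _ p => (X' p.1 p.2, E' p.1 p.2)) n
  let X : ℕ → Set V := fun n => (st n).1
  let E : ℕ → Finset V := fun n => (st n).2
  let U : ℕ → Finset V := fun n => U' (X n) (E n)
  let f : ℕ → V → V := fun n => f' (X n) (E n)
  have hPn : ∀ n, P (X n) (E n) := by
    intro n
    induction n with
    | zero => exact h₀
    | succ n ih => exact hP' _ _ ih
  have hXmono : Monotone X := monotone_nat_of_le_succ fun n => hmono _ _ (hPn n)
  have hcard : ∀ n, (E n).card < (E (n + 1)).card := fun n => hcard _ _ (hPn n)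
  have hdisj : ∀ n, ∀ e ∈ E n, e ∉ E (n + 1) := fun n => hdisj _ _ (hPn n)
  have hUX : ∀ n, ∀ u ∈ U n, u ∉ X n := fun n => hUX _ _ (hPn n)
  have hUX' : ∀ n, ∀ u ∈ U n, u ∉ E (n + 1) → u ∈ X (n + 1) := fun n => hUX' _ _ (hPn n)
  have hEU : ∀ n, E n ⊆ U n := fun n => hEU _ _ (hPn n)
  have hE'U : ∀ n, E (n + 1) ⊆ U n := fun n => hE'U _ _ (hPn n)
  have hf : ∀ n, ∀ u ∈ U n, u ∉ E (n + 1) →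
      f n u ∈ U n ∧ f n u ∉ E n ∧ (f n u = u ∨ G.Adj u (f n u)) := fun n => hf _ _ (hPn n)
  have hinj : ∀ n, ∀ u ∈ U n, ∀ v ∈ U n, u ∉ E (n + 1) → v ∉ E (n + 1) →
      f n u = f n v → u = v := fun n => hinj _ _ (hPn n)
  have hnext : ∀ n, ∀ u ∈ E (n + 1), u ∉ E (n + 2) := fun n => hdisj (n + 1)
  have hdom : ∀ i j u, i < j → u ∈ U i → u ∈ U j → u ∈ E (i + 1) := by
    intro i j u hij hi hj
    by_contra h
    exact hUX j u hj (hXmono hij (hUX' i u hi h))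
  have hfar : ∀ i j u, i < j → u ∈ U i → u ∈ U j → j = i + 1 := by
    intro i j u hij hi hj
    by_contra h
    have h1 := hdom i j u hij hi hj
    have h2 := hdom (i + 1) j u (by omega) (hEU (_ + 1) h1) hj
    exact hnext i u h1 h2
  have hdomain : ∀ i j u, u ∈ U i → u ∈ U j → u ∉ E (i + 1) → u ∉ E (j + 1) → i = j := by
    intro i j u hi hj hi' hj'
    rcases lt_trichotomy i j with h | h | h
    · exact absurd (hdom i j u h hi hj) hi'
    · exact h
    · exact absurd (hdom j i u h hj hi) hj'
  have hrange : ∀ i j u, u ∈ U i → u ∈ U j → u ∉ E i → u ∉ E j → i = j := by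
    have aux : ∀ i j u, i < j → u ∈ U i → u ∈ U j → u ∈ E j := by
      intro i j u hij hi hj
      rw [hfar i j u hij hi hj]
      exact hdom i j u hij hi hj
    intro i j u hi hj hi' hj'
    rcases lt_trichotomy i j with h | h | h
    · exact absurd (aux i j u h hi hj) hj'
    · exact h
    · exact absurd (aux j i u h hj hi) hi'
  let R : V → V → Prop := fun u v => u ≠ v ∧ ∃ n, u ∈ U n ∧ u ∉ E (n + 1) ∧ f n u = v
  have hflow : IsRayFlow G R := by
    refine ⟨?_, ?_, ?_, ?_⟩
    · rintro u v ⟨hne, n, hu, hu', rfl⟩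
      exact (hf n u hu hu').2.2.resolve_left hne.symm
    · rintro u v v' ⟨-, n, hu, hu', rfl⟩ ⟨-, n', hv, hv', rfl⟩
      rw [hdomain n n' u hu hv hu' hv']
    · rintro u u' v ⟨-, n, hu, hu', rfl⟩ ⟨-, n', hv, hv', h⟩
      obtain ⟨h1, h2, -⟩ := hf n u hu hu'
      obtain ⟨h3, h4, -⟩ := hf n' u' hv hv'
      rw [h] at h3 h4
      obtain rfl := hrange _ _ _ h1 h3 h2 h4
      exact hinj n u hu u' hv hu' hv' h.symm
    · rintro w u ⟨hne, n, hw, hw', rfl⟩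
      obtain ⟨h1, h2, -⟩ := hf n w hw hw'
      by_cases hu' : f n w ∈ E (n + 1)
      · refine ⟨_, ?_, n + 1, hEU (_ + 1) hu', hnext n _ hu', rfl⟩
        intro h
        exact (hf (n + 1) _ (hEU (_ + 1) hu') (hnext n _ hu')).2.1 (h ▸ hu')
      · exact ⟨_, fun h => hne (hinj n w hw _ h1 hw' hu' h), n, h1, hu', rfl⟩
  have hb : ∀ n, ∃ b ∈ U n, b ∉ E n ∧ ∀ w ∈ U n, w ∉ E (n + 1) → f n w ≠ b := by
    intro n
    have hlt : ((U n \ E (n + 1)).image (f n)).card < (U n \ E n).card := by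
      refine Finset.card_image_le.trans_lt ?_
      rw [Finset.card_sdiff_of_subset (hE'U n), Finset.card_sdiff_of_subset (hEU n)]
      have := Finset.card_le_card (hE'U n)
      have := hcard n
      omega
    obtain ⟨b, hb, hb'⟩ := Finset.exists_mem_notMem_of_card_lt_card hlt
    rw [Finset.mem_sdiff] at hb
    refine ⟨b, hb.1, hb.2, fun w hw hw' h => hb' ?_⟩
    exact Finset.mem_image.2 ⟨w, Finset.mem_sdiff.2 ⟨hw, hw'⟩, h⟩
  choose b hbU hbE hbf using hb
  have hb_inj : Function.Injective b := fun i j h =>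
    hrange i j (b i) (hbU i) (h ▸ hbU j) (hbE i) (h ▸ hbE j)
  have hb_out : ∀ n, ∃ v, R (b n) v := by
    intro n
    by_cases hu' : b n ∈ E (n + 1)
    · refine ⟨_, ?_, n + 1, hEU (_ + 1) hu', hnext n _ hu', rfl⟩
      intro h
      exact (hf (n + 1) _ (hEU (_ + 1) hu') (hnext n _ hu')).2.1 (h ▸ hu')
    · exact ⟨_, (hbf n _ (hbU n) hu').symm, n, hbU n, hu', rfl⟩
  have hb_in : ∀ n w, ¬ R w (b n) := by
    rintro n w ⟨-, m, hw, hw', h⟩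
    obtain ⟨h1, h2, -⟩ := hf m w hw hw'
    rw [h] at h1 h2
    obtain rfl := hrange _ _ _ h1 (hbU n) h2 (hbE n)
    exact hbf m w hw hw' h
  obtain ⟨r, h1, h2, -⟩ := hflow.exists_rays b hb_inj hb_out hb_in
  exact ⟨r, h1, h2⟩

/-- A tail of a ray is a ray. -/
theorem IsRay.tail {G : SimpleGraph V} {f : ℕ → V} (hf : IsRay G f) (t : ℕ) :
    IsRay G fun n => f (t + n) :=
  ⟨fun a b h => by simpa using hf.1 h, fun n => hf.2 (t + n)⟩

/-- A ray eventually avoids every finite set. -/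
theorem IsRay.eventually_notMem {G : SimpleGraph V} {f : ℕ → V} (hf : IsRay G f)
    (S : Finset V) : ∃ t, ∀ n, t ≤ n → f n ∉ S := by
  have h : Set.Finite (f ⁻¹' (S : Set V)) := S.finite_toSet.preimage hf.1.injOn
  obtain ⟨t, ht⟩ := h.bddAbove
  exact ⟨t + 1, fun n hn hS => absurd (ht (show n ∈ f ⁻¹' (S : Set V) from hS)) (by omega)⟩

/-- The rayless set `A` is separated from the rest of `G` by the finite set `S`. -/
structure RaylessSep (G : SimpleGraph V) (A : Set V) (S : Finset V) : Prop where
  boundary : ∀ a ∈ A, ∀ b ∉ A, G.Adj a b → b ∈ S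
  disjoint : ∀ a ∈ A, a ∉ S
  rayless : ∀ f, IsRay G f → ∃ n, f n ∉ A

theorem RaylessSep.empty (G : SimpleGraph V) : RaylessSep G ∅ ∅ :=
  ⟨by simp, by simp, fun _ _ => ⟨0, by simp⟩⟩

/-- A ray eventually leaves a rayless set with finite boundary. -/
theorem RaylessSep.eventually_notMem {G : SimpleGraph V} {A : Set V} {S : Finset V}
    (h : RaylessSep G A S) {f : ℕ → V} (hf : IsRay G f) : ∃ t, ∀ n, t ≤ n → f n ∉ A := by
  obtain ⟨t, ht⟩ := hf.eventually_notMem S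
  refine ⟨t, fun n hn hA => ?_⟩
  have hstay : ∀ m, f (n + m) ∈ A := by
    intro m
    induction m with
    | zero => exact hA
    | succ m ih =>
      by_contra hc
      exact ht (n + m + 1) (by omega) (h.boundary _ ih _ hc (hf.2 _))
  obtain ⟨m, hm⟩ := h.rayless _ (hf.tail n)
  exact hm (hstay m)

theorem RaylessSep.union {G : SimpleGraph V} {A A' : Set V} {S S' : Finset V}
    (h : RaylessSep G A S) (h' : RaylessSep G A' S') :
    ∃ T, RaylessSep G (A ∪ A') T ∧ ∀ v ∈ T, (v ∈ S ∨ v ∈ S') ∧ v ∉ A ∪ A' := by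
  classical
  refine ⟨(S ∪ S').filter (· ∉ A ∪ A'), ⟨?_, ?_, ?_⟩, ?_⟩
  · rintro a (ha | ha) b hb hab
    · have := h.boundary a ha b (fun hc => hb (Or.inl hc)) hab
      exact Finset.mem_filter.2 ⟨Finset.mem_union_left _ this, hb⟩
    · have := h'.boundary a ha b (fun hc => hb (Or.inr hc)) hab
      exact Finset.mem_filter.2 ⟨Finset.mem_union_right _ this, hb⟩
  · intro a ha hc
    exact (Finset.mem_filter.1 hc).2 ha
  · intro f hf
    obtain ⟨t, ht⟩ := h.eventually_notMem hf
    obtain ⟨t', ht'⟩ := h'.eventually_notMem hf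
    refine ⟨max t t', ?_⟩
    rintro (hc | hc)
    · exact ht _ (le_max_left _ _) hc
    · exact ht' _ (le_max_right _ _) hc
  · intro v hv
    rw [Finset.mem_filter, Finset.mem_union] at hv
    exact hv

/-- The vertex `v` is not separated by a finite set from all rays. -/
def IsRayBound (G : SimpleGraph V) (v : V) : Prop :=
  ∀ S : Finset V, v ∉ S → ∃ f, IsRay G f ∧ f 0 = v ∧ ∀ n, f n ∉ S

/-- A vertex separated from all rays by a finite set lies in a rayless set with finite
boundary. -/
theorem exists_raylessSep_of_not_isRayBound {G : SimpleGraph V} {v : V}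
    (hv : ¬ IsRayBound G v) : ∃ A S, RaylessSep G A S ∧ v ∈ A := by
  simp only [IsRayBound, not_forall] at hv
  obtain ⟨S, hvS, hS⟩ := hv
  refine ⟨{w | w ∉ S ∧ ¬ ∃ f, IsRay G f ∧ f 0 = w ∧ ∀ n, f n ∉ S}, S, ⟨?_, ?_, ?_⟩, hvS, hS⟩
  · rintro a ⟨haS, ha⟩ b hb hab
    by_contra hbS
    have : ∃ f, IsRay G f ∧ f 0 = b ∧ ∀ n, f n ∉ S := by
      by_contra hc
      exact hb ⟨hbS, hc⟩
    obtain ⟨f, hf, rfl, hfS⟩ := this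
    by_cases hmem : ∃ n, f n = a
    · obtain ⟨n, rfl⟩ := hmem
      exact ha ⟨_, hf.tail n, rfl, fun m => hfS _⟩
    · let g : ℕ → V := fun n => n.casesOn a f
      refine ha ⟨g, ⟨?_, ?_⟩, rfl, ?_⟩
      · rintro (_ | n) (_ | m) h
        · rfl
        · exact absurd ⟨m, h.symm⟩ hmem
        · exact absurd ⟨n, h⟩ hmem
        · exact congrArg _ (hf.1 h)
      · rintro (_ | n)
        · exact hab
        · exact hf.2 n
      · rintro (_ | n)
        · exact haS
        · exact hfS n
  · exact fun a ha => ha.1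
  · intro f hf
    by_contra hc
    have hc := not_exists_not.1 hc
    exact (hc 0).2 ⟨f, hf, rfl, fun n => (hc n).1⟩

/-- If all vertices can be separated from all rays, then finite sets are contained in rayless sets
with finite boundary. -/
theorem exists_raylessSep_of_finset {G : SimpleGraph V} (hG : ∀ v, ¬ IsRayBound G v)
    (X : Finset V) : ∃ A S, RaylessSep G A S ∧ ∀ x ∈ X, x ∈ A := by
  classical
  induction X using Finset.induction_on with
  | empty => exact ⟨∅, ∅, .empty G, by simp⟩
  | insert x X _ ih =>
    obtain ⟨A, S, hA, hX⟩ := ih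
    obtain ⟨B, T, hB, hx⟩ := exists_raylessSep_of_not_isRayBound (hG x)
    obtain ⟨T', hT', -⟩ := hA.union hB
    refine ⟨A ∪ B, T', hT', ?_⟩
    intro y hy
    rcases Finset.mem_insert.1 hy with rfl | hy
    · exact Or.inr hx
    · exact Or.inl (hX y hy)

/-- If the boundaries of rayless sets containing a given finite set cannot be bounded uniformly,
then there are infinitely many disjoint rays. -/
theorem hasDisjointRays_of_unbounded {G : SimpleGraph V} (hG : ∀ v, ¬ IsRayBound G v)
    (hunb : ∀ d : ℕ, ∃ X : Finset V, ∀ A S, RaylessSep G A S → (∀ x ∈ X, x ∈ A) → d < S.card) :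
    HasDisjointRays G := by
  classical
  refine hasDisjointRays_of_linkages G (fun A S => RaylessSep G A S ∧
    ∀ A' S', RaylessSep G A' S' → A ⊆ A' → S.card ≤ S'.card) ⟨∅, ∅, .empty G, by simp⟩ ?_
  rintro A S ⟨hA, hmin⟩
  obtain ⟨X, hX⟩ := hunb S.card
  let p : ℕ → Prop := fun n => ∃ A' S', RaylessSep G A' S' ∧ A ⊆ A' ∧ (∀ s ∈ S, s ∈ A') ∧
    (∀ x ∈ X, x ∈ A') ∧ S'.card = n
  have hp : ∃ n, p n := by
    obtain ⟨B, T, hB, hBX⟩ := exists_raylessSep_of_finset hG (S ∪ X)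
    obtain ⟨T', hT', -⟩ := hA.union hB
    exact ⟨_, A ∪ B, T', hT', Set.subset_union_left,
      fun s hs => Or.inr (hBX s (Finset.mem_union_left _ hs)),
      fun s hs => Or.inr (hBX s (Finset.mem_union_right _ hs)), rfl⟩
  obtain ⟨A', S', hA', hAA', hSA', hXA', hcard⟩ := Nat.find_spec hp
  have hlink := exists_linkage G {v | (v ∈ A' ∨ v ∈ S') ∧ v ∉ A} S S'
    (fun e he => ⟨Or.inl (hSA' e he), fun hc => hA.disjoint e hc he⟩)
    (fun e he => ⟨Or.inr he, fun hc => hA'.disjoint e (hAA' hc) he⟩) (by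
      intro Z Q hZ hSQ hQ hcl
      let B : Set V := {v | v ∈ A ∨ v ∈ Q ∧ v ∈ A' ∧ v ∉ Z}
      have hB : RaylessSep G B (Z.filter (· ∉ B)) := by
        refine ⟨?_, fun a ha hc => (Finset.mem_filter.1 hc).2 ha, ?_⟩
        · intro a ha b hb hab
          refine Finset.mem_filter.2 ⟨?_, hb⟩
          by_contra hbZ
          have hbA : b ∉ A := fun hc => hb (Or.inl hc)
          rcases ha with ha | ⟨haQ, haA', haZ⟩
          · have hbS := hA.boundary a ha b hbA hab
            exact hb (Or.inr ⟨(hSQ b hbS).resolve_right hbZ, hSA' b hbS, hbZ⟩)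
          · have hbΩ : b ∈ A' ∨ b ∈ S' := by
              by_cases h : b ∈ A'
              · exact Or.inl h
              · exact Or.inr (hA'.boundary a haA' b h hab)
            have hbQ := (hcl a haQ b ⟨hbΩ, hbA⟩ hab).resolve_right hbZ
            rcases hbΩ with h | h
            · exact hb (Or.inr ⟨hbQ, h, hbZ⟩)
            · exact hQ b h hbQ
        · intro f hf
          obtain ⟨n, hn⟩ := hA'.rayless f hf
          exact ⟨n, fun hc => hn (hc.elim (fun h => hAA' h) fun h => h.2.1)⟩
      have h1 := hmin _ _ hB fun a ha => Or.inl ha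
      have h2 := Finset.card_filter_le Z (· ∉ B)
      omega)
  obtain ⟨U, f, hU, hSU, hS'U, hf, hinj⟩ := hlink
  refine ⟨A', S', ⟨hA', ?_⟩, hX A' S' hA' hXA', ?_, hAA', U, f, fun u hu => (hU u hu).2,
    fun u hu hu' => (hU u hu).1.resolve_right hu', hSU, hS'U, hf, hinj⟩
  · intro A'' S'' hA'' hsub
    rw [hcard]
    exact Nat.find_min' hp ⟨A'', S'', hA'', hAA'.trans hsub, fun s hs => hsub (hSA' s hs),
      fun x hx => hsub (hXA' x hx), rfl⟩
  · exact fun e he => hA'.disjoint e (hSA' e he)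

/-- Every set containing `v` and closed under adjacency off a finite set missing `v` meets the ray
`r` outside that finite set, in a vertex other than `v`. -/
def Dominates (G : SimpleGraph V) (v : V) (r : ℕ → V) : Prop :=
  ∀ (S : Finset V) (Q : Set V), v ∉ S → v ∈ Q → (∀ a ∈ Q, ∀ b ∉ S, G.Adj a b → b ∈ Q) →
    ∃ n, r n ∈ Q ∧ r n ∉ S ∧ r n ≠ v

/-- If `v` dominates `r`, then sets as in `Dominates` contain a tail of `r`. -/
theorem Dominates.exists_tail {G : SimpleGraph V} {v : V} {r : ℕ → V} (h : Dominates G v r)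
    (hr : IsRay G r) {S : Finset V} {Q : Set V} (hvQ : v ∈ Q)
    (hQ : ∀ a ∈ Q, ∀ b ∉ S, G.Adj a b → b ∈ Q) : ∃ t, ∀ n, t ≤ n → r n ∈ Q := by
  classical
  obtain ⟨t, ht⟩ := hr.eventually_notMem S
  obtain ⟨n, hnQ, hnS, hnv⟩ := h ((S ∪ (Finset.range t).image r).erase v) Q (by simp) hvQ (by
    intro a ha b hb hab
    by_cases hbv : b = v
    · exact hbv ▸ hvQ
    · refine hQ a ha b (fun hc => hb ?_) hab
      exact Finset.mem_erase.2 ⟨hbv, Finset.mem_union_left _ hc⟩)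
  have htn : t ≤ n := by
    by_contra hlt
    refine hnS (Finset.mem_erase.2 ⟨hnv, Finset.mem_union_right _ ?_⟩)
    exact Finset.mem_image.2 ⟨n, Finset.mem_range.2 (by omega), rfl⟩
  refine ⟨n, fun m hm => ?_⟩
  induction m, hm using Nat.le_induction with
  | base => exact hnQ
  | succ m hm ih => exact hQ _ ih _ (ht _ (by omega)) (hr.2 m)

/-- A ray dominated by infinitely many vertices yields infinitely many disjoint rays. -/
theorem hasDisjointRays_of_dominates {G : SimpleGraph V} {r : ℕ → V} (hr : IsRay G r)
    (hD : {v | Dominates G v r}.Infinite) : HasDisjointRays G := by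
  classical
  refine hasDisjointRays_of_linkages G (fun X E => X.Finite ∧ (∀ e ∈ E, Dominates G e r) ∧
    ∀ e ∈ E, e ∉ X) ⟨∅, ∅, by simp⟩ ?_
  rintro X E ⟨hX, hE, hEX⟩
  obtain ⟨E', hE', hcard⟩ := (hD.sdiff (hX.union E.finite_toSet)).exists_subset_card_eq
    (E.card + 1)
  have hE'X : ∀ e ∈ E', e ∉ X := fun e he hc => (hE' he).2 (Or.inl hc)
  have hE'E : ∀ e ∈ E', e ∉ E := fun e he hc => (hE' he).2 (Or.inr hc)
  obtain ⟨U, f, hU, hEU, hE'U, hf, hinj⟩ := exists_linkage G Xᶜ E E' hEX hE'X (by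
    intro Z Q hZ hEQ hE'Q hcl
    obtain ⟨e, he, heZ⟩ := Finset.exists_mem_notMem_of_card_lt_card hZ
    obtain ⟨e', he', he'Z⟩ := Finset.exists_mem_notMem_of_card_lt_card
      (show Z.card < E'.card by omega)
    let S := hX.toFinset ∪ Z
    have hS : ∀ {v}, v ∉ S ↔ v ∉ X ∧ v ∉ Z := by
      intro v; simp [S]
    have hclS : ∀ a ∈ Q, ∀ b ∉ S, G.Adj a b → b ∈ Q := fun a ha b hb hab =>
      (hcl a ha b (hS.1 hb).1 hab).resolve_right (hS.1 hb).2
    obtain ⟨t, ht⟩ := (hE e he).exists_tail hr (S := S)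
      ((hEQ e he).resolve_right heZ) hclS
    obtain ⟨t', ht'⟩ := Dominates.exists_tail (hE' he').1 hr (S := S) (Q := {v | v ∉ Q ∧ v ∉ S})
      ⟨hE'Q e' he', hS.2 ⟨hE'X e' he', he'Z⟩⟩
      (fun a ha b hb hab => ⟨fun hbQ => ha.1 (hclS b hbQ a ha.2 hab.symm), hb⟩)
    exact (ht' (max t t') (le_max_right _ _)).1 (ht _ (le_max_left _ _)))
  refine ⟨X ∪ {u | u ∈ U ∧ u ∉ E'}, E', ⟨hX.union (U.finite_toSet.subset fun u hu => hu.1),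
    fun e he => (hE' he).1, ?_⟩, by omega, fun e he hc => hE'E e hc he, Set.subset_union_left,
    U, f, hU, fun u hu hu' => Or.inr ⟨hu, hu'⟩, hEU, hE'U, hf, hinj⟩
  rintro e he (hc | hc)
  · exact hE'X e he hc
  · exact hc.2 he

/-- Without infinitely many disjoint rays, some finite family of rays meets all rays. -/
theorem exists_rays_meeting_all {G : SimpleGraph V} (hG : ¬ HasDisjointRays G) :
    ∃ (n : ℕ) (r : Fin n → ℕ → V), (∀ i, IsRay G (r i)) ∧
      ∀ f, IsRay G f → ∃ i m m', f m = r i m' := by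
  classical
  by_contra! hcon
  apply hG
  obtain ⟨f, hf, hdisj⟩ := exists_seq_of_forall_finset_exists (IsRay G)
    (fun x y : ℕ → V => Disjoint (Set.range x) (Set.range y)) (by
      intro s hs
      obtain ⟨f, hf, hfs⟩ := hcon s.card (fun i => (s.equivFin.symm i : ℕ → V))
        fun i => hs _ (s.equivFin.symm i).2
      refine ⟨f, hf, fun x hx => ?_⟩
      rw [Set.disjoint_left]
      rintro _ ⟨m', rfl⟩ ⟨m, h⟩
      exact hfs (s.equivFin ⟨x, hx⟩) m m' (by simpa using h))
  refine ⟨f, hf, fun i j hij => ?_⟩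
  rcases hij.lt_or_gt with h | h
  · exact hdisj i j h
  · exact (hdisj j i h).symm

/-- Without infinitely many disjoint rays, only finitely many vertices cannot be separated from
all rays by finite sets. -/
theorem finite_isRayBound {G : SimpleGraph V} (hG : ¬ HasDisjointRays G) :
    {v | IsRayBound G v}.Finite := by
  classical
  by_contra hinf
  obtain ⟨n, r, hr, hmeet⟩ := exists_rays_meeting_all hG
  have hdom : ∀ v, IsRayBound G v → ∃ i, Dominates G v (r i) := by
    intro v hv
    by_contra! hc
    simp only [Dominates, not_forall, not_exists, not_and] at hc
    choose S Q hvS hvQ hcl hQ using hc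
    obtain ⟨f, hf, hf0, hfS⟩ := hv (Finset.univ.biUnion S) (by simp [hvS])
    have hfQ : ∀ i m, f m ∈ Q i := by
      intro i m
      induction m with
      | zero => exact hf0 ▸ hvQ i
      | succ m ih =>
        refine hcl i _ ih _ (fun hc => hfS (m + 1) ?_) (hf.2 m)
        exact Finset.mem_biUnion.2 ⟨i, Finset.mem_univ _, hc⟩
    obtain ⟨i, m, m', h⟩ := hmeet _ (hf.tail 1)
    refine hQ i m' (h ▸ hfQ i _) (fun hc => hfS (1 + m) ?_) ?_
    · exact Finset.mem_biUnion.2 ⟨i, Finset.mem_univ _, h ▸ hc⟩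
    · intro hc
      have := hf.1 ((h.trans hc).trans hf0.symm)
      omega
  apply hinf
  refine Set.Finite.subset (Set.finite_iUnion fun i => ?_) (fun v hv => Set.mem_iUnion.2 (hdom v hv))
  by_contra hi
  exact hG (hasDisjointRays_of_dominates (hr i) hi)

/-- The vertices `u` and `v` are consecutive on one of the rays of `F`. -/
def kRayRel {k : ℕ} (F : Fin k → ℕ → V) (u v : V) : Prop := ∃ i n, F i n = u ∧ F i (n + 1) = v

theorem IsKRay.eq_of_eq {G : SimpleGraph V} {k : ℕ} {F : Fin k → ℕ → V} (hF : IsKRay G F)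
    {i j : Fin k} {n m : ℕ} (h : F i n = F j m) : i = j ∧ n = m := by
  have hij : i = j := by
    by_contra hne
    exact Set.disjoint_left.1 (hF.2 hne) ⟨n, rfl⟩ ⟨m, h.symm⟩
  subst hij
  exact ⟨rfl, (hF.1 i).1 h⟩

theorem IsKRay.isRayFlow {G : SimpleGraph V} {k : ℕ} {F : Fin k → ℕ → V} (hF : IsKRay G F) :
    IsRayFlow G (kRayRel F) := by
  refine ⟨?_, ?_, ?_, ?_⟩
  · rintro _ _ ⟨i, n, rfl, rfl⟩
    exact (hF.1 i).2 n
  · rintro _ _ _ ⟨i, n, rfl, rfl⟩ ⟨j, m, h, rfl⟩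
    obtain ⟨rfl, rfl⟩ := hF.eq_of_eq h
    rfl
  · rintro _ _ _ ⟨i, n, rfl, rfl⟩ ⟨j, m, rfl, h⟩
    obtain ⟨rfl, h'⟩ := hF.eq_of_eq h
    rw [Nat.succ.inj h']
  · rintro _ _ ⟨i, n, rfl, rfl⟩
    exact ⟨_, i, n + 1, rfl, rfl⟩

theorem IsKRay.tail {G : SimpleGraph V} {k : ℕ} {F : Fin k → ℕ → V} (hF : IsKRay G F) (t : ℕ) :
    IsKRay G fun i n => F i (t + n) := by
  refine ⟨fun i => (hF.1 i).tail t, fun i j hij => (hF.2 hij).mono ?_ ?_⟩ <;>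
  · rintro _ ⟨n, rfl⟩
    exact ⟨t + n, rfl⟩

theorem kRayRel.of_tail {k : ℕ} {F : Fin k → ℕ → V} {t : ℕ} {u v : V}
    (h : kRayRel (fun i n => F i (t + n)) u v) : kRayRel F u v := by
  obtain ⟨i, n, rfl, rfl⟩ := h
  exact ⟨i, t + n, rfl, rfl⟩

theorem mem_kRayEdges {k : ℕ} {F : Fin k → ℕ → V} {e : Sym2 V} :
    e ∈ kRayEdges F ↔ ∃ u v, e = s(u, v) ∧ kRayRel F u v := by
  simp only [kRayEdges, rayEdges, Set.mem_iUnion, Set.mem_ofPred_eq]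
  constructor
  · rintro ⟨i, n, rfl⟩
    exact ⟨_, _, rfl, i, n, rfl, rfl⟩
  · rintro ⟨_, _, rfl, i, n, rfl, rfl⟩
    exact ⟨i, n, rfl⟩

theorem kRayEdges_tail_subset {k : ℕ} (F : Fin k → ℕ → V) (t : ℕ) :
    kRayEdges (fun i n => F i (t + n)) ⊆ kRayEdges F := by
  intro e he
  obtain ⟨u, v, rfl, h⟩ := mem_kRayEdges.1 he
  exact mem_kRayEdges.2 ⟨u, v, rfl, h.of_tail⟩

/-- The relations `R` and `R'` cross `S` in the same way, with respect to the side `A`. -/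
structure FlowAgree (A : Set V) (S : Finset V) (R R' : V → V → Prop) : Prop where
  out : ∀ u ∈ S, (∃ v, R u v) ↔ ∃ v, R' u v
  outBelow : ∀ u ∈ S, (∃ v ∈ A, R u v) ↔ ∃ v ∈ A, R' u v
  inBelow : ∀ u ∈ S, (∃ v ∈ A, R v u) ↔ ∃ v ∈ A, R' v u

theorem FlowAgree.trans {A : Set V} {S : Finset V} {R R' R'' : V → V → Prop}
    (h : FlowAgree A S R R') (h' : FlowAgree A S R' R'') : FlowAgree A S R R'' :=
  ⟨fun u hu => (h.out u hu).trans (h'.out u hu),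
    fun u hu => (h.outBelow u hu).trans (h'.outBelow u hu),
    fun u hu => (h.inBelow u hu).trans (h'.inBelow u hu)⟩

/-- Truncating a `k`-ray inside `A` does not affect how it crosses the boundary. -/
theorem flowAgree_tail {k : ℕ} {F : Fin k → ℕ → V} {t : ℕ} {A : Set V}
    {S : Finset V} (hAS : ∀ a ∈ A, a ∉ S) (ht : ∀ i, ∀ n ≤ t, F i n ∈ A) :
    FlowAgree A S (kRayRel fun i n => F i (t + n)) (kRayRel F) := by
  have hout : ∀ u ∈ S, ∀ v, kRayRel F u v → kRayRel (fun i n => F i (t + n)) u v := by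
    rintro _ hu _ ⟨i, n, rfl, rfl⟩
    have hn : t < n := by
      by_contra hc
      exact hAS _ (ht i n (by omega)) hu
    obtain ⟨m, rfl⟩ := Nat.exists_eq_add_of_lt hn
    exact ⟨i, m + 1, rfl, rfl⟩
  have hin : ∀ u ∈ S, ∀ v, kRayRel F v u → kRayRel (fun i n => F i (t + n)) v u := by
    rintro _ hu _ ⟨i, n, rfl, rfl⟩
    have hn : t < n + 1 := by
      by_contra hc
      exact hAS _ (ht i (n + 1) (by omega)) hu
    obtain ⟨m, rfl⟩ := Nat.exists_eq_add_of_le (Nat.lt_succ_iff.1 hn)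
    exact ⟨i, m, rfl, rfl⟩
  exact ⟨fun u hu => ⟨fun ⟨v, h⟩ => ⟨v, h.of_tail⟩, fun ⟨v, h⟩ => ⟨v, hout u hu v h⟩⟩,
    fun u hu => ⟨fun ⟨v, hv, h⟩ => ⟨v, hv, h.of_tail⟩, fun ⟨v, hv, h⟩ => ⟨v, hv, hout u hu v h⟩⟩,
    fun u hu => ⟨fun ⟨v, hv, h⟩ => ⟨v, hv, h.of_tail⟩, fun ⟨v, hv, h⟩ => ⟨v, hv, hin u hu v h⟩⟩⟩

/-- The edge `uv` meets `A (N + 1)` but not `A N`. -/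
def InLayer (A : ℕ → Set V) (N : ℕ) (u v : V) : Prop :=
  (u ∈ A (N + 1) ∨ v ∈ A (N + 1)) ∧ u ∉ A N ∧ v ∉ A N

theorem InLayer.symm {A : ℕ → Set V} {N : ℕ} {u v : V} (h : InLayer A N u v) :
    InLayer A N v u :=
  ⟨h.1.symm, h.2.2, h.2.1⟩

theorem InLayer.le {A : ℕ → Set V} (hA : Monotone A) {N N' : ℕ} {u v : V}
    (h : InLayer A N u v) (h' : InLayer A N' u v) : N' ≤ N := by
  by_contra hlt
  rcases h.1 with h1 | h1
  · exact h'.2.1 (hA (by omega) h1)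
  · exact h'.2.2 (hA (by omega) h1)

theorem InLayer.unique {A : ℕ → Set V} (hA : Monotone A) {N N' : ℕ} {u v : V}
    (h : InLayer A N u v) (h' : InLayer A N' u v) : N = N' :=
  (h'.le hA h).antisymm (h.le hA h')

/-- Ray flows that agree along nested finite boundaries can be glued layer by layer. -/
theorem exists_glued_rays {G : SimpleGraph V} {A : ℕ → Set V} {S : ℕ → Finset V}
    (hA : ∀ N, RaylessSep G (A N) (S N)) (hnest : ∀ N v, v ∈ A N ∨ v ∈ S N → v ∈ A (N + 1))
    {R : ℕ → V → V → Prop} (hR : ∀ N, IsRayFlow G (R N))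
    (hagree : ∀ N, FlowAgree (A (N + 1)) (S (N + 1)) (R N) (R (N + 1)))
    (havoid : ∀ u v, R 0 u v → u ∉ A 0 ∧ v ∉ A 0)
    {ι : Type*} (b : ι → V) (hb : Function.Injective b) (hbA : ∀ i, b i ∈ A 1)
    (hbout : ∀ i, ∃ v, R 0 (b i) v) (hbin : ∀ i w, ¬ R 0 w (b i)) :
    ∃ r : ι → ℕ → V, (∀ i, IsRay G (r i)) ∧
      (Pairwise fun i j => Disjoint (Set.range (r i)) (Set.range (r j))) ∧
      ∀ i n, ∃ N, R N (r i n) (r i (n + 1)) ∧ InLayer A N (r i n) (r i (n + 1)) := by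
  have hmono : Monotone A := monotone_nat_of_le_succ fun N v hv => hnest N v (Or.inl hv)
  have hnbr : ∀ {N u v}, G.Adj u v → v ∈ A N → u ∉ A N → u ∈ S N := fun huv hv hu =>
    (hA _).boundary _ hv _ hu huv.symm
  -- two layers meeting at a vertex are equal or consecutive
  have hlayers : ∀ {N N' u v v'}, N < N' → G.Adj u v → InLayer A N u v → InLayer A N' u v' →
      N' = N + 1 ∧ u ∈ S (N + 1) ∧ v ∈ A (N + 1) := by
    intro N N' u v v' hlt huv h h'
    have hu : u ∉ A (N + 1) := fun hc => h'.2.1 (hmono (by omega) hc)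
    have hv := h.1.resolve_left hu
    have huS := hnbr huv hv hu
    refine ⟨?_, huS, hv⟩
    by_contra hne
    exact h'.2.1 (hmono (show N + 2 ≤ N' by omega) (hnest _ _ (Or.inr huS)))
  have hfun : ∀ {N N' u v v'}, N < N' → R N u v → InLayer A N u v → R N' u v' →
      InLayer A N' u v' → False := by
    intro N N' u v v' hlt h hl h' hl'
    obtain ⟨rfl, huS, hv⟩ := hlayers hlt ((hR N).adj h) hl hl'
    obtain ⟨x, hx, hux⟩ := ((hagree N).outBelow u huS).1 ⟨v, hv, h⟩
    rw [(hR _).functional hux h'] at hx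
    exact hl'.2.2 hx
  have hinj : ∀ {N N' u v v'}, N < N' → R N v u → InLayer A N v u → R N' v' u →
      InLayer A N' v' u → False := by
    intro N N' u v v' hlt h hl h' hl'
    obtain ⟨rfl, huS, hv⟩ := hlayers hlt ((hR N).adj h).symm hl.symm hl'.symm
    obtain ⟨x, hx, hux⟩ := ((hagree N).inBelow u huS).1 ⟨v, hv, h⟩
    rw [(hR _).injective hux h'] at hx
    exact hl'.2.1 hx
  let Q : V → V → Prop := fun u v => ∃ N, R N u v ∧ InLayer A N u v
  have hQ : IsRayFlow G Q := by
    refine ⟨?_, ?_, ?_, ?_⟩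
    · rintro u v ⟨N, h, -⟩
      exact (hR N).adj h
    · rintro u v v' ⟨N, h, hl⟩ ⟨N', h', hl'⟩
      rcases lt_trichotomy N N' with hlt | rfl | hlt
      · exact (hfun hlt h hl h' hl').elim
      · exact (hR N).functional h h'
      · exact (hfun hlt h' hl' h hl).elim
    · rintro u u' v ⟨N, h, hl⟩ ⟨N', h', hl'⟩
      rcases lt_trichotomy N N' with hlt | rfl | hlt
      · exact (hinj hlt h hl h' hl').elim
      · exact (hR N).injective h h'
      · exact (hinj hlt h' hl' h hl).elim
    · rintro w u ⟨N, h, hl⟩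
      obtain ⟨v, huv⟩ := (hR N).total h
      by_cases hu : u ∈ A (N + 1)
      · by_cases hv : v ∈ A N
        · have huS := hnbr ((hR N).adj huv) hv hl.2.2
          cases N with
          | zero => exact absurd hv (havoid u v huv).2
          | succ M =>
            obtain ⟨x, hx, hux⟩ := ((hagree M).outBelow u huS).2 ⟨v, hv, huv⟩
            refine ⟨x, M, hux, Or.inr hx, fun hc => hl.2.2 (hmono (by omega) hc), fun hc => ?_⟩
            have : u ∉ A M := fun hc => hl.2.2 (hmono (by omega) hc)
            exact hl.2.2 (hnest M u (Or.inr (hnbr ((hR M).adj hux) hc this)))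
        · exact ⟨v, N, huv, Or.inl hu, hl.2.2, hv⟩
      · have huS := hnbr ((hR N).adj h).symm (hl.1.resolve_right hu) hu
        by_cases hv : v ∈ A (N + 1)
        · refine ⟨v, N, huv, Or.inr hv, hl.2.2, fun hc => hu (hnest N u (Or.inr ?_))⟩
          exact hnbr ((hR N).adj huv) hc hl.2.2
        · obtain ⟨x, hux⟩ := ((hagree N).out u huS).1 ⟨v, huv⟩
          refine ⟨x, N + 1, hux, Or.inl (hnest _ _ (Or.inr huS)), hu, fun hc => hv ?_⟩
          obtain ⟨y, hy, huy⟩ := ((hagree N).outBelow u huS).2 ⟨x, hc, hux⟩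
          rwa [(hR N).functional huv huy]
  refine hQ.exists_rays b hb ?_ ?_
  · intro i
    obtain ⟨v, hv⟩ := hbout i
    exact ⟨v, 0, hv, Or.inl (hbA i), havoid _ _ hv⟩
  · rintro i w ⟨N, h, hl⟩
    cases N with
    | zero => exact hbin i w h
    | succ N => exact hl.2.2 (hmono (by omega) (hbA i))

/-- If rayless sets with boundaries of size at most `d` cover all finite sets, then a countable set
of vertices is exhausted by a nested sequence of such sets. -/
theorem exists_nested_raylessSep {G : SimpleGraph V} {d : ℕ}
    (hd : ∀ X : Finset V, ∃ A S, RaylessSep G A S ∧ (∀ x ∈ X, x ∈ A) ∧ S.card ≤ d) (e : ℕ → V) :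
    ∃ (A : ℕ → Set V) (S : ℕ → Finset V), (∀ n, RaylessSep G (A n) (S n)) ∧
      (∀ n, (S n).card ≤ d) ∧ (∀ n v, v ∈ A n ∨ v ∈ S n → v ∈ A (n + 1)) ∧
      ∀ n, e n ∈ A (n + 1) := by
  classical
  have hstep : ∀ (n : ℕ) (p : {p : Set V × Finset V // RaylessSep G p.1 p.2 ∧ p.2.card ≤ d}),
      ∃ q : {p : Set V × Finset V // RaylessSep G p.1 p.2 ∧ p.2.card ≤ d},
        (∀ v, v ∈ p.1.1 ∨ v ∈ p.1.2 → v ∈ q.1.1) ∧ e n ∈ q.1.1 := by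
    rintro n ⟨⟨A, S⟩, hA, -⟩
    obtain ⟨B, T, hB, hX, hT⟩ := hd (insert (e n) S)
    obtain ⟨T', hT', hsub⟩ := hA.union hB
    have hcard : T'.card ≤ d := by
      refine (Finset.card_le_card fun v hv => ?_).trans hT
      obtain ⟨hv1, hv2⟩ := hsub v hv
      exact hv1.resolve_left fun hc => hv2 (Or.inr (hX v (Finset.mem_insert_of_mem hc)))
    refine ⟨⟨(A ∪ B, T'), hT', hcard⟩, ?_, Or.inr (hX _ (Finset.mem_insert_self _ _))⟩
    rintro v (hv | hv)
    · exact Or.inl hv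
    · exact Or.inr (hX v (Finset.mem_insert_of_mem hv))
  choose nxt h1 h2 using hstep
  let p : ℕ → {p : Set V × Finset V // RaylessSep G p.1 p.2 ∧ p.2.card ≤ d} := fun n =>
    Nat.rec ⟨(∅, ∅), .empty G, by simp⟩ nxt n
  exact ⟨fun n => (p n).1.1, fun n => (p n).1.2, fun n => (p n).2.1, fun n => (p n).2.2,
    fun n => h1 n (p n), fun n => h2 n (p n)⟩

/-- Arbitrarily large pairwise related families remain available inside one class of a finite
colouring. -/
theorem exists_monochromatic_families {α T : Type*} [Finite T] (c : α → T) (P : α → Prop)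
    (D : α → α → Prop)
    (h : ∀ n : ℕ, ∃ F : Fin n → α, (∀ m, P (F m)) ∧ Pairwise fun m m' => D (F m) (F m')) :
    ∃ τ, ∀ n : ℕ, ∃ F : Fin n → α, (∀ m, P (F m) ∧ c (F m) = τ) ∧
      Pairwise fun m m' => D (F m) (F m') := by
  classical
  have := Fintype.ofFinite T
  by_contra! hcon
  choose N hN using hcon
  obtain ⟨F, hP, hD⟩ := h (∑ τ, N τ + 1)
  have hlt : ∀ τ, Fintype.card {m // c (F m) = τ} ≤ N τ := by
    intro τ
    by_contra! hc
    obtain ⟨g⟩ := Function.Embedding.nonempty_of_card_le (α := Fin (N τ))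
      (β := {m // c (F m) = τ}) (by simpa using hc.le)
    exact hN τ (fun m => F (g m)) (fun m => ⟨hP _, (g m).2⟩)
      fun m m' hne => hD fun heq => hne (g.injective (Subtype.ext heq))
  have hsum := Fintype.card_congr (Equiv.sigmaFiberEquiv fun m => c (F m))
  rw [Fintype.card_sigma, Fintype.card_fin] at hsum
  have := Finset.sum_le_sum fun τ (_ : τ ∈ Finset.univ) => hlt τ
  omega

/-- How the relation `R` crosses `S` with respect to the side `A`, in terms of labels of the
vertices of `S`. -/
def crossingState {ι : Type*} (l : V → ι) (A : Set V) (S : Finset V) (R : V → V → Prop) :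
    Set ι × Set ι × Set ι :=
  (l '' {u | u ∈ S ∧ ∃ v, R u v}, l '' {u | u ∈ S ∧ ∃ v ∈ A, R u v},
    l '' {u | u ∈ S ∧ ∃ v ∈ A, R v u})

theorem flowAgree_of_crossingState_eq {ι : Type*} {l : V → ι} {A : Set V} {S : Finset V}
    (hl : Set.InjOn l S) {R R' : V → V → Prop}
    (h : crossingState l A S R = crossingState l A S R') : FlowAgree A S R R' := by
  have aux : ∀ {p q : V → Prop}, l '' {u | u ∈ S ∧ p u} = l '' {u | u ∈ S ∧ q u} →
      ∀ u ∈ S, p u ↔ q u := by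
    intro p q hpq u hu
    have := (hl.image_eq_image_iff (fun v hv => hv.1) (fun v hv => hv.1)).1 hpq
    have := Set.ext_iff.1 this u
    simpa [hu] using this
  simp only [crossingState, Prod.mk.injEq] at h
  exact ⟨aux h.1, aux h.2.1, aux h.2.2⟩

/-- A finite set of at most `d` elements can be labelled injectively by `Fin (d + 1)`. -/
theorem exists_injOn_fin {d : ℕ} {S : Finset V} (hS : S.card ≤ d) :
    ∃ l : V → Fin (d + 1), Set.InjOn l S := by
  classical
  refine ⟨fun v => if h : v ∈ S then (S.equivFin ⟨v, h⟩).castLE (by omega) else 0, ?_⟩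
  intro u hu v hv h
  have hu : u ∈ S := hu
  have hv : v ∈ S := hv
  simp only [hu, hv, dite_true] at h
  simpa using h

/-- A function to a finite type is constant along every ultrafilter. -/
theorem Ultrafilter.exists_eventually_eq {α T : Type*} [Finite T] (U : Ultrafilter α) (f : α → T) :
    ∃ τ, ∀ᶠ x in U, f x = τ := by
  obtain ⟨τ, hτ⟩ := (U.map f).eq_pure_of_finite
  refine ⟨τ, ?_⟩
  have : ({τ} : Set T) ∈ U.map f := by
    rw [hτ]
    exact Set.mem_singleton τ
  exact this

/-- The ubiquity statement for graphs in which all finite sets of vertices are separated from all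
rays by sets of bounded size. -/
theorem exists_edgeDisjoint_kRays_of_bounded {G : SimpleGraph V} {d k : ℕ}
    (hd : ∀ X : Finset V, ∃ A S, RaylessSep G A S ∧ (∀ x ∈ X, x ∈ A) ∧ S.card ≤ d)
    (h : ∀ n : ℕ, ∃ F : Fin n → Fin k → ℕ → V, (∀ m, IsKRay G (F m)) ∧
      Pairwise fun m m' => Disjoint (kRayEdges (F m)) (kRayEdges (F m'))) :
    ∃ F : ℕ → Fin k → ℕ → V, (∀ m, IsKRay G (F m)) ∧
      Pairwise fun m m' => Disjoint (kRayEdges (F m)) (kRayEdges (F m')) := by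
  rcases Nat.eq_zero_or_pos k with rfl | hk
  · refine ⟨fun _ i => i.elim0, fun _ => ⟨fun i => i.elim0, fun i => i.elim0⟩, fun _ _ _ => ?_⟩
    refine Set.disjoint_left.2 fun x hx => ?_
    obtain ⟨i, -⟩ := Set.mem_iUnion.1 hx
    exact i.elim0
  choose Fam hFam hFamD using h
  have : Nonempty V := ⟨Fam 1 0 ⟨0, hk⟩ 0⟩
  obtain ⟨e, he⟩ : ∃ e : ℕ → V, ∀ n m i t, Fam n m i t ∈ Set.range e := by
    have hc : (Set.range fun x : (Σ n, Fin n) × Fin k × ℕ =>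
        Fam x.1.1 x.1.2 x.2.1 x.2.2).Countable := Set.countable_range _
    obtain ⟨e, he⟩ := Set.countable_iff_exists_subset_range.1 hc
    exact ⟨e, fun n m i t => he ⟨(⟨n, m⟩, i, t), rfl⟩⟩
  obtain ⟨A, S, hA, hS, hnest, heA⟩ := exists_nested_raylessSep hd e
  have hmono : Monotone A := monotone_nat_of_le_succ fun N v hv => hnest N v (Or.inl hv)
  choose l hl using fun n => exists_injOn_fin (hS n)
  let U := Filter.hyperfilter ℕ
  have hU : ∀ {p : ℕ → Prop}, (∀ᶠ n in Filter.atTop, p n) → ∀ᶠ n in U, p n := fun hp =>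
    Filter.Eventually.filter_mono Nat.hyperfilter_le_atTop hp
  let state : ℕ → (Fin k → ℕ → V) → Set (Fin (d + 1)) × Set (Fin (d + 1)) × Set (Fin (d + 1)) :=
    fun j F => crossingState (l j) (A j) (S j) (kRayRel F)
  choose c hc using fun F => U.exists_eventually_eq fun j => state j F
  obtain ⟨τ, hτ⟩ := exists_monochromatic_families c
    (fun F => IsKRay G F ∧ ∀ i n, F i n ∈ Set.range e)
    (fun F F' => Disjoint (kRayEdges F) (kRayEdges F'))
    fun n => ⟨Fam n, fun m => ⟨hFam n m, he n m⟩, hFamD n⟩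
  choose F hF hFD using hτ
  let K : ℕ → ℕ → Fin k → ℕ → V := fun N m => F (N + 1) (Fin.ofNat (N + 1) m)
  have hK : ∀ N m, IsKRay G (K N m) := fun N m => (hF _ _).1.1
  have hKD : ∀ N m m', m ≤ N → m' ≤ N → m ≠ m' →
      Disjoint (kRayEdges (K N m)) (kRayEdges (K N m')) := by
    intro N m m' hm hm' hne
    refine hFD _ fun heq => hne ?_
    have := congrArg Fin.val heq
    simpa [Fin.ofNat, Nat.mod_eq_of_lt (Nat.lt_succ_of_le hm),
      Nat.mod_eq_of_lt (Nat.lt_succ_of_le hm')] using this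
  have hKev : ∀ N, ∀ᶠ j in U, ∀ m, state j (K N m) = τ := by
    intro N
    have : ∀ᶠ j in U, ∀ m : Fin (N + 1), state j (F (N + 1) m) = τ :=
      Filter.eventually_all.2 fun m => (hc (F (N + 1) m)).mono fun j hj => hj.trans (hF _ m).2
    exact this.mono fun j hj m => hj _
  have hKmem : ∀ N m i n, ∀ᶠ j in Filter.atTop, K N m i n ∈ A j := by
    intro N m i n
    obtain ⟨t, ht⟩ := (hF (N + 1) (Fin.ofNat (N + 1) m)).1.2 i n
    refine Filter.eventually_atTop.2 ⟨t + 1, fun j hj => hmono hj ?_⟩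
    change F (N + 1) (Fin.ofNat (N + 1) m) i n ∈ A (t + 1)
    rw [← ht]
    exact heA t
  have hT : ∀ N a, ∃ t, ∀ i n, t ≤ n → K N N i n ∉ A a := by
    intro N a
    choose t ht using fun i => (hA a).eventually_notMem ((hK N N).1 i)
    exact ⟨Finset.univ.sup t, fun i n hn =>
      ht i n ((Finset.le_sup (f := t) (Finset.mem_univ i)).trans hn)⟩
  choose T hT using hT
  have hnxt : ∀ N a, ∃ b, a < b ∧ (∀ m, state b (K N m) = τ) ∧ (∀ m, state b (K (N + 1) m) = τ) ∧
      ∀ i, ∀ n ≤ T N a, K N N i n ∈ A b := by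
    intro N a
    have hmem : ∀ᶠ j in Filter.atTop, ∀ i, ∀ n ≤ T N a, K N N i n ∈ A j :=
      Filter.eventually_all.2 fun i => (Filter.eventually_all_finite (Set.finite_Iic _)).2
        fun n _ => hKmem N N i n
    exact ((hU (Filter.eventually_gt_atTop a)).and
      ((hKev N).and ((hKev (N + 1)).and (hU hmem)))).exists
  choose nxt hlt hst hst' hin using hnxt
  let j : ℕ → ℕ := fun N => Nat.rec 0 nxt N
  have hj : ∀ N, j (N + 1) = nxt N (j N) := fun _ => rfl
  have hjmono : StrictMono j := strictMono_nat_of_lt_succ fun N => hlt N (j N)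
  have hB : ∀ N v, v ∈ A (j N) ∨ v ∈ S (j N) → v ∈ A (j (N + 1)) := fun N v hv =>
    hmono (hlt N (j N)) (hnest _ v hv)
  have hBmono : Monotone fun N => A (j N) := hmono.comp hjmono.monotone
  have hglue : ∀ m, ∃ r : Fin k → ℕ → V, IsKRay G r ∧ ∀ i n, ∃ N, m ≤ N ∧
      kRayRel (K N m) (r i n) (r i (n + 1)) ∧
      InLayer (fun N => A (j N)) N (r i n) (r i (n + 1)) := by
    intro m
    let t := T m (j m)
    let R : ℕ → V → V → Prop := fun N => Nat.casesOn N (kRayRel fun i n => K m m i (t + n))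
      fun N => kRayRel (K (m + N + 1) m)
    have hR0 : ∀ {u v}, R 0 u v → kRayRel (K m m) u v := fun h => h.of_tail
    obtain ⟨r, hr, hrD, hrE⟩ := exists_glued_rays (A := fun N => A (j (m + N)))
      (S := fun N => S (j (m + N))) (R := R) (fun N => hA _) (fun N => hB (m + N))
      (by
        rintro (_ | N)
        · exact ((hK m m).tail t).isRayFlow
        · exact (hK _ _).isRayFlow)
      (by
        rintro (_ | N)
        · refine (flowAgree_tail (hA _).disjoint (hin m (j m))).trans
            (flowAgree_of_crossingState_eq (hl _) ((hst m (j m) m).trans (hst' m (j m) m).symm))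
        · exact flowAgree_of_crossingState_eq (hl _)
            ((hst (m + N + 1) _ m).trans (hst' (m + N + 1) _ m).symm))
      (by
        rintro _ _ ⟨i, n, rfl, rfl⟩
        exact ⟨hT m (j m) i _ (Nat.le_add_right _ _), hT m (j m) i _ (Nat.le_add_right _ _)⟩)
      (fun i => K m m i t) (fun i i' h => ((hK m m).eq_of_eq h).1)
      (fun i => hin m (j m) i t le_rfl) (fun i => ⟨_, i, 0, rfl, rfl⟩)
      (by
        rintro i _ ⟨i', n, rfl, h⟩
        have := ((hK m m).eq_of_eq h).2
        omega)
    refine ⟨r, ⟨hr, hrD⟩, fun i n => ?_⟩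
    obtain ⟨N, hN, hL⟩ := hrE i n
    refine ⟨m + N, Nat.le_add_right _ _, ?_, hL⟩
    cases N with
    | zero => exact hR0 hN
    | succ N => exact hN
  choose r hr hrE using hglue
  have hrE' : ∀ {m x}, x ∈ kRayEdges (r m) → ∃ u v N, x = s(u, v) ∧ m ≤ N ∧
      x ∈ kRayEdges (K N m) ∧ InLayer (fun N => A (j N)) N u v := by
    intro m x hx
    obtain ⟨_, _, rfl, i, n, rfl, rfl⟩ := mem_kRayEdges.1 hx
    obtain ⟨N, hmN, hN, hL⟩ := hrE m i n
    exact ⟨_, _, N, rfl, hmN, mem_kRayEdges.2 ⟨_, _, rfl, hN⟩, hL⟩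
  refine ⟨r, hr, fun m m' hne => Set.disjoint_left.2 fun x hx hx' => ?_⟩
  obtain ⟨u, v, N, hxe, hmN, hxK, hL⟩ := hrE' hx
  obtain ⟨u', v', N', hxe', hmN', hxK', hL'⟩ := hrE' hx'
  have hNN : N = N' := by
    rcases Sym2.eq_iff.1 (hxe.symm.trans hxe') with ⟨rfl, rfl⟩ | ⟨rfl, rfl⟩
    · exact hL.unique hBmono hL'
    · exact hL.unique hBmono hL'.symm
  subst hNN
  exact Set.disjoint_left.1 (hKD N m m' hmN hmN' hne) hxK hxK'

theorem HasDisjointRays.exists_edgeDisjoint_kRays {G : SimpleGraph V} (hG : HasDisjointRays G)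
    (k : ℕ) :
    ∃ F : ℕ → Fin k → ℕ → V, (∀ m, IsKRay G (F m)) ∧
      Pairwise fun m m' => Disjoint (kRayEdges (F m)) (kRayEdges (F m')) := by
  obtain ⟨r, hr, hD⟩ := hG
  refine ⟨fun m i => r (Nat.pair m i), fun m => ⟨fun i => hr _, fun i i' hne => hD fun h => ?_⟩,
    fun m m' hne => Set.disjoint_left.2 fun x hx hx' => ?_⟩
  · exact hne (Fin.ext (Nat.pair_eq_pair.1 h).2)
  · obtain ⟨u, v, rfl, i, n, rfl, rfl⟩ := mem_kRayEdges.1 hx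
    obtain ⟨u', v', h, i', n', rfl, rfl⟩ := mem_kRayEdges.1 hx'
    have hdis := Set.disjoint_left.1 (hD fun h => hne (Nat.pair_eq_pair.1 h).1 :
      Disjoint (Set.range (r (Nat.pair m i))) (Set.range (r (Nat.pair m' i'))))
    rcases Sym2.eq_iff.1 h with ⟨h, -⟩ | ⟨h, -⟩
    · exact hdis ⟨n, rfl⟩ ⟨n', h.symm⟩
    · exact hdis ⟨n, rfl⟩ ⟨n' + 1, h.symm⟩

/-- Edge-ubiquity of the `k`-ray: if for every `n` there are `n` pairwise
edge-disjoint `k`-rays, then there are infinitely many. -/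
theorem stmt_19 (G : SimpleGraph V) (k : ℕ)
    (h : ∀ n : ℕ, ∃ F : Fin n → Fin k → ℕ → V, (∀ m, IsKRay G (F m)) ∧
      Pairwise fun m m' => Disjoint (kRayEdges (F m)) (kRayEdges (F m'))) :
    ∃ F : ℕ → Fin k → ℕ → V, (∀ m, IsKRay G (F m)) ∧
      Pairwise fun m m' => Disjoint (kRayEdges (F m)) (kRayEdges (F m')) := by
  by_cases hG : HasDisjointRays G
  · exact hG.exists_edgeDisjoint_kRays k
  have hfin := finite_isRayBound hG
  let H : SimpleGraph V :=
    { Adj := fun u v => G.Adj u v ∧ ¬ IsRayBound G u ∧ ¬ IsRayBound G v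
      symm := ⟨fun u v h => ⟨h.1.symm, h.2.2, h.2.1⟩⟩
      loopless := ⟨fun u h => h.1.ne rfl⟩ }
  have hHG : ∀ {f}, IsRay H f → IsRay G f := fun hf => ⟨hf.1, fun n => (hf.2 n).1⟩
  have hHbound : ∀ v, ¬ IsRayBound H v := by
    intro v hv
    obtain ⟨f, hf, rfl, -⟩ := hv ∅ (Finset.notMem_empty v)
    refine (hf.2 0).2.1 fun S hS => ?_
    obtain ⟨g, hg, h0, hgS⟩ := hv S hS
    exact ⟨g, hHG hg, h0, hgS⟩
  have hH : ¬ HasDisjointRays H := fun ⟨r, hr, hD⟩ => hG ⟨r, fun i => hHG (hr i), hD⟩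
  obtain ⟨d, hd⟩ : ∃ d : ℕ, ∀ X : Finset V, ∃ A S, RaylessSep H A S ∧ (∀ x ∈ X, x ∈ A) ∧
      S.card ≤ d := by
    by_contra! hcon
    exact hH (hasDisjointRays_of_unbounded hHbound hcon)
  have hKH : ∀ F : Fin k → ℕ → V, IsKRay G F →
      ∃ F' : Fin k → ℕ → V, IsKRay H F' ∧ kRayEdges F' ⊆ kRayEdges F := by
    intro F hF
    choose t ht using fun i => (hF.1 i).eventually_notMem hfin.toFinset
    have hmem : ∀ i n, ¬ IsRayBound G (F i (Finset.univ.sup t + n)) := by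
      intro i n hb
      exact ht i _ ((Finset.le_sup (f := t) (Finset.mem_univ i)).trans (Nat.le_add_right _ _))
        (hfin.mem_toFinset.2 hb)
    have htail := hF.tail (Finset.univ.sup t)
    exact ⟨_, ⟨fun i => ⟨(htail.1 i).1, fun n => ⟨(htail.1 i).2 n, hmem i n, hmem i (n + 1)⟩⟩,
      htail.2⟩, kRayEdges_tail_subset F _⟩
  choose φ hφ hφE using hKH
  obtain ⟨F, hF, hFD⟩ := exists_edgeDisjoint_kRays_of_bounded hd fun n => by
    obtain ⟨F, hF, hFD⟩ := h n
    exact ⟨fun m => φ (F m) (hF m), fun m => hφ _ (hF m), fun m m' hne =>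
      (hFD hne).mono (hφE _ (hF m)) (hφE _ (hF m'))⟩
  exact ⟨F, fun m => ⟨fun i => hHG ((hF m).1 i), (hF m).2⟩, hFD⟩
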